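/- arXiv:2105.08747 — 5 statements merged into one kernel-verified Lean document; each statement's English description precedes it below -/
import Mathlib

section
/- Let Z_1, …, Z_{n+1} be exchangeable real-valued random variables and let α ∈ (0,1) satisfy ⌈(1−α)(n+1)⌉ ≤ n. Let Z_{(k)} denote the k-th smallest value among Z_1,…,Z_n. Then P( Z_{n+1} ≤ Z_{(⌈(1−α)(n+1)⌉)} ) ≥ 1 − α. -/
open MeasureTheory

/-- The vectors for which fewer than `k` coordinates lie strictly below coordinate `j`. -/
def strictRankLT (ι : Type*) [Fintype ι] (k : ℕ) (j : ι) : Set (ι → ℝ) :=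
  {x | (Finset.univ.filter (fun i => x i < x j)).card < k}

lemma measurableSet_strictRankLT {ι : Type*} [Fintype ι] (k : ℕ) (j : ι) :
    MeasurableSet (strictRankLT ι k j) := by
  have h : Measurable fun x : ι → ℝ => (Finset.univ.filter (fun i => x i < x j)).card := by
    simp only [Finset.card_filter]
    refine Finset.measurable_sum _ fun i _ => ?_
    exact Measurable.ite (measurableSet_lt (measurable_pi_apply i) (measurable_pi_apply j))
      measurable_const measurable_const
  exact h measurableSet_Iio

lemma comp_perm_mem_strictRankLT {ι : Type*} [Fintype ι] (k : ℕ) (j : ι) (σ : Equiv.Perm ι)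
    (x : ι → ℝ) : (fun i => x (σ i)) ∈ strictRankLT ι k j ↔ x ∈ strictRankLT ι k (σ j) := by
  have h : (Finset.univ.filter (fun i => x (σ i) < x (σ j))).card
      = (Finset.univ.filter (fun i => x i < x (σ j))).card :=
    Finset.card_equiv σ (by simp)
  simp only [strictRankLT, Set.mem_ofPred_eq, h]

open Classical in
/-- At least `k` coordinates of a vector have strict rank less than `k`. -/
lemma le_card_strictRankLT {ι : Type*} [Fintype ι] {k : ℕ} (hk : k ≤ Fintype.card ι)
    (x : ι → ℝ) : k ≤ (Finset.univ.filter (fun j => x ∈ strictRankLT ι k j)).card := by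
  by_cases hB : (Finset.univ.filter (fun j => x ∉ strictRankLT ι k j)).Nonempty
  · obtain ⟨j, hj, hmin⟩ := Finset.exists_min_image _ x hB
    have hj' : k ≤ (Finset.univ.filter (fun i => x i < x j)).card := by
      simpa [strictRankLT] using hj
    refine hj'.trans (Finset.card_le_card fun i hi => ?_)
    simp only [Finset.mem_filter, Finset.mem_univ, true_and] at hi hmin ⊢
    by_contra hc
    exact absurd hi (not_lt.mpr (hmin i hc))
  · rw [Finset.not_nonempty_iff_eq_empty, Finset.filter_eq_empty_iff] at hB
    rw [Finset.filter_true_of_mem fun j hj => not_not.mp (hB hj)]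
    simpa using hk

lemma le_sum_measure_strictRankLT {ι : Type*} [Fintype ι] {k : ℕ} (hk : k ≤ Fintype.card ι)
    (μ : Measure (ι → ℝ)) [IsProbabilityMeasure μ] :
    (k : ENNReal) ≤ ∑ j, μ (strictRankLT ι k j) := by
  classical
  calc (k : ENNReal) = ∫⁻ _, (k : ENNReal) ∂μ := by simp
    _ ≤ ∫⁻ x, ∑ j, (strictRankLT ι k j).indicator 1 x ∂μ := by
        refine lintegral_mono fun x => ?_
        simp only [Set.indicator_apply, Pi.one_apply, Finset.sum_boole]
        exact_mod_cast le_card_strictRankLT hk x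
    _ = ∑ j, μ (strictRankLT ι k j) := by
        rw [lintegral_finsetSum _ fun j _ =>
          measurable_one.indicator (measurableSet_strictRankLT k j)]
        simp only [lintegral_indicator_one (measurableSet_strictRankLT k _)]

lemma le_sInf_of_mem_strictRankLT {n k : ℕ} (hk : k ≤ n) {x : Fin (n + 1) → ℝ}
    (hx : x ∈ strictRankLT (Fin (n + 1)) k (Fin.last n)) :
    x (Fin.last n) ≤
      sInf {z : ℝ | k ≤ (Finset.univ.filter (fun i : Fin n => x i.castSucc ≤ z)).card} := by
  refine le_csInf ?_ fun z hz => ?_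
  · obtain ⟨M, hM⟩ := (Set.finite_range x).bddAbove
    refine ⟨M, ?_⟩
    rw [Set.mem_ofPred_eq, Finset.filter_true_of_mem fun i _ => hM ⟨i.castSucc, rfl⟩]
    simpa using hk
  · by_contra! hlt
    rw [strictRankLT, Set.mem_ofPred_eq] at hx
    refine absurd hx (not_lt.mpr (le_trans hz ?_))
    refine Finset.card_le_card_of_injOn Fin.castSucc (fun i hi => ?_)
      (Fin.castSucc_injective n).injOn
    simp only [Finset.coe_filter, Finset.mem_univ, true_and, Set.mem_ofPred_eq] at hi ⊢
    exact hi.trans_lt hlt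

/--
Let `Z 0, …, Z n` be exchangeable real-valued random variables and let
`α ∈ (0,1)` satisfy `⌈(1-α)(n+1)⌉ ≤ n`.  Writing `Z_(k)` for the `k`-th smallest value among
the first `n` variables (realized here as the infimum of all `z` below which at least `k` of
the first `n` variables lie), we have `P(Z (n+1) ≤ Z_(⌈(1-α)(n+1)⌉)) ≥ 1 - α`.
-/
theorem exchangeable_empirical_quantile_coverage
    {Ω : Type*} [MeasurableSpace Ω] (P : Measure Ω) [IsProbabilityMeasure P]
    (n : ℕ) (Z : Fin (n + 1) → Ω → ℝ)
    (hZmeas : ∀ i, Measurable (Z i))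
    (hexch : ∀ σ : Equiv.Perm (Fin (n + 1)),
      Measure.map (fun ω => fun i => Z (σ i) ω) P
        = Measure.map (fun ω => fun i => Z i ω) P)
    (α : ℝ) (hα0 : 0 < α) (hα1 : α < 1)
    (hk : ⌈(1 - α) * ((n : ℝ) + 1)⌉₊ ≤ n) :
    ENNReal.ofReal (1 - α) ≤
      P {ω | Z (Fin.last n) ω ≤
        sInf {z : ℝ | ⌈(1 - α) * ((n : ℝ) + 1)⌉₊ ≤
          (Finset.univ.filter (fun i : Fin n => Z i.castSucc ω ≤ z)).card}} := by
  set k := ⌈(1 - α) * ((n : ℝ) + 1)⌉₊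
  set μ := Measure.map (fun ω => fun i => Z i ω) P with hμ
  have hZ : Measurable fun ω => fun i => Z i ω := measurable_pi_lambda _ hZmeas
  have : IsProbabilityMeasure μ := Measure.isProbabilityMeasure_map hZ.aemeasurable
  have heq (j : Fin (n + 1)) : μ (strictRankLT _ k j) = μ (strictRankLT _ k (Fin.last n)) := by
    let σ := Equiv.swap j (Fin.last n)
    have hσ : Measurable fun ω => fun i => Z (σ i) ω := measurable_pi_lambda _ fun i => hZmeas _
    have hlast : μ (strictRankLT _ k (Fin.last n))
        = Measure.map (fun ω => fun i => Z (σ i) ω) P (strictRankLT _ k (Fin.last n)) := by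
      rw [hexch σ]
    rw [hlast, hμ, Measure.map_apply hZ (measurableSet_strictRankLT k _),
      Measure.map_apply hσ (measurableSet_strictRankLT k _)]
    congr 1
    ext ω
    have h := comp_perm_mem_strictRankLT k (Fin.last n) σ (fun i => Z i ω)
    rw [show σ (Fin.last n) = j from Equiv.swap_apply_right _ _] at h
    exact h.symm
  have hsum := le_sum_measure_strictRankLT (k := k) (by simpa using hk.trans n.le_succ) μ
  simp only [heq, Finset.sum_const, Finset.card_univ, Fintype.card_fin, nsmul_eq_mul] at hsum
  have hα : ENNReal.ofReal (1 - α) ≤ μ (strictRankLT _ k (Fin.last n)) := by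
    rw [ENNReal.ofReal_le_iff_le_toReal (measure_ne_top _ _)]
    have hreal := ENNReal.toReal_mono (ENNReal.mul_ne_top (by simp) (measure_ne_top _ _)) hsum
    rw [ENNReal.toReal_mul, ENNReal.toReal_natCast, ENNReal.toReal_natCast] at hreal
    push_cast at hreal
    have hceil : (1 - α) * ((n : ℝ) + 1) ≤ k := Nat.le_ceil _
    have hn : (0 : ℝ) < n + 1 := by positivity
    refine le_of_mul_le_mul_right ?_ hn
    linarith
  refine hα.trans ?_
  rw [hμ, Measure.map_apply hZ (measurableSet_strictRankLT k _)]
  exact measure_mono fun ω hω => le_sInf_of_mem_strictRankLT hk hω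
end

section
/- Fix C > 0, m ∈ ℕ, η > 0 and τ ∈ (0,1) with τ + 2η^{1/3} ≤ 1. Let x be such that Y | X = x has a continuous conditional CDF F(· | x) with density f(· | x) supported on [−C, C], and let π̂(x) be a histogram on the grid b_0,…,b_m satisfying max_{1 ≤ j ≤ m} | F̂(b_j | x) − F(b_j | x) | ≤ η^{1/3}. Let [l*, u*] with −C < l* ≤ u* < C be an interval of minimal length with ∫_{l*}^{u*} f(y | x) dy ≥ τ + 2η^{1/3}. Then any optimal interval [ĵ_1, ĵ_2] for (π̂(x), τ) satisfies b_{ĵ_2} − b_{ĵ_1 − 1} ≤ (u* − l*) + 4C/m. -/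
open MeasureTheory

/-- `(l,u)` is feasible for `(π, τ)` on `m` bins: `1 ≤ l ≤ u ≤ m` and `Σ_{j=l}^u π_j ≥ τ`. -/
def FeasibleInterval (m : ℕ) (π : ℕ → ℝ) (τ : ℝ) (q : ℕ × ℕ) : Prop :=
  1 ≤ q.1 ∧ q.1 ≤ q.2 ∧ q.2 ≤ m ∧ τ ≤ ∑ j ∈ Finset.Icc q.1 q.2, π j

/-- `(l,u)` is an optimal interval for `(π, τ)`: feasible, of minimal length `u - l` among all
feasible pairs and, among those of minimal length, of minimal mass. -/
def IsOptimalInterval (m : ℕ) (π : ℕ → ℝ) (τ : ℝ) (q : ℕ × ℕ) : Prop :=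
  FeasibleInterval m π τ q ∧ ∀ r, FeasibleInterval m π τ r →
    q.2 - q.1 ≤ r.2 - r.1 ∧
    (r.2 - r.1 = q.2 - q.1 →
      ∑ j ∈ Finset.Icc q.1 q.2, π j ≤ ∑ j ∈ Finset.Icc r.1 r.2, π j)

/--
**deterministic core of the near-optimal-length lemma.**  If the estimated
histogram `πh` on the grid `b j = -C + 2Cj/m` is uniformly `η^{1/3}`-accurate for the true
conditional CDF `F` (with density `f` supported on `[-C, C]`), and `[l*, u*] ⊆ (-C, C)` is a
shortest interval with `∫_{l*}^{u*} f ≥ τ + 2η^{1/3}`, then any optimal interval `[j₁, j₂]`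
for `(πh, τ)` satisfies `b j₂ - b (j₁ - 1) ≤ (u* - l*) + 4C/m`.
-/
theorem discrete_interval_near_oracle_length
    (C : ℝ) (hC : 0 < C) (m : ℕ) (hm : 1 ≤ m)
    (η τ : ℝ) (hη : 0 < η) (hτ0 : 0 < τ) (hτ1 : τ < 1)
    (hτη : τ + 2 * η ^ ((1 : ℝ) / 3) ≤ 1)
    (b : ℕ → ℝ) (hb : ∀ j, b j = -C + 2 * C * j / m)
    (f : ℝ → ℝ) (hf0 : ∀ y, 0 ≤ f y)
    (hfsupp : ∀ y, y ∉ Set.Icc (-C) C → f y = 0)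
    (hfint : Integrable f) (hftot : (∫ y, f y) = 1)
    (F : ℝ → ℝ) (hF : ∀ y, F y = ∫ t in Set.Iic y, f t)
    (hFcont : Continuous F)
    (πh : ℕ → ℝ) (hπ0 : ∀ j, 0 ≤ πh j) (hπ1 : ∑ j ∈ Finset.Icc 1 m, πh j = 1)
    (hacc : ∀ j, 1 ≤ j → j ≤ m →
      |(∑ j' ∈ Finset.Icc 1 j, πh j') - F (b j)| ≤ η ^ ((1 : ℝ) / 3))
    (lo uo : ℝ) (hlo : -C < lo) (hlu : lo ≤ uo) (huo : uo < C)
    (hmass : τ + 2 * η ^ ((1 : ℝ) / 3) ≤ ∫ y in lo..uo, f y)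
    (hopt : ∀ l u : ℝ, l ≤ u → τ + 2 * η ^ ((1 : ℝ) / 3) ≤ (∫ y in l..u, f y) →
      uo - lo ≤ u - l)
    (j1 j2 : ℕ) (hj : IsOptimalInterval m πh τ (j1, j2)) :
    b j2 - b (j1 - 1) ≤ (uo - lo) + 4 * C / m := by
  obtain ⟨⟨hj1, hj12, hj2m, -⟩, hmin⟩ := hj
  simp only at hj1 hj12 hj2m hmin
  set ε := η ^ ((1 : ℝ) / 3) with hε
  have hε0 : 0 < ε := Real.rpow_pos_of_pos hη _
  have hm0 : (0 : ℝ) < m := by exact_mod_cast hm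
  have hlu' : lo < uo := by
    rcases hlu.lt_or_eq with h | h
    · exact h
    · rw [h, intervalIntegral.integral_same] at hmass
      linarith
  -- position of a point in units of bins
  have hgrid : ∀ y : ℝ, y = -C + 2 * C * ((y + C) * m / (2 * C)) / m := by
    intro y
    field_simp
    ring
  have hpos : ∀ y : ℝ, -C < y → 0 < (y + C) * m / (2 * C) := by
    intro y hy
    have : 0 < y + C := by linarith
    positivity
  set s := (lo + C) * m / (2 * C) with hs
  set t := (uo + C) * m / (2 * C) with ht
  have hs0 : 0 < s := hpos lo hlo
  have ht0 : 0 < t := hpos uo (by linarith)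
  have htm : t ≤ m := by
    rw [ht, div_le_iff₀ (by linarith)]
    nlinarith
  have hst : s < t := by
    rw [hs, ht]
    gcongr
  have hp := Nat.floor_le hs0.le
  have hp' := Nat.lt_floor_add_one s
  have hq := Nat.le_ceil t
  have hq' := Nat.ceil_lt_add_one ht0.le
  have hqm : ⌈t⌉₊ ≤ m := Nat.ceil_le.2 htm
  generalize ⌊s⌋₊ = p at hp hp'
  generalize ⌈t⌉₊ = q at hq hq' hqm
  have hpq : p < q := by
    have : (p : ℝ) < q := by linarith
    exact_mod_cast this
  have hbp : b p ≤ lo := by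
    rw [hb, hgrid lo]
    gcongr
  have hbq : uo ≤ b q := by
    rw [hb, hgrid uo]
    gcongr
  have hmassgrid : ∫ y in lo..uo, f y ≤ F (b q) - F (b p) := by
    rw [hF, hF, intervalIntegral.integral_Iic_sub_Iic hfint.integrableOn hfint.integrableOn]
    exact intervalIntegral.integral_mono_interval hbp hlu hbq
      (Filter.Eventually.of_forall hf0) hfint.intervalIntegrable
  have hlower : (∑ j ∈ Finset.Icc 1 p, πh j) - F (b p) ≤ ε := by
    rcases Nat.eq_zero_or_pos p with h | h
    · have hFp : 0 ≤ F (b p) := by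
        rw [hF]
        exact integral_nonneg hf0
      have : ∑ j ∈ Finset.Icc 1 p, πh j = 0 := by simp [h]
      linarith
    · exact (abs_le.1 (hacc p h (by omega))).2
  have hupper := (abs_le.1 (hacc q (by omega) hqm)).1
  have hsplit : ∑ j ∈ Finset.Icc 1 q, πh j =
      ∑ j ∈ Finset.Icc 1 p, πh j + ∑ j ∈ Finset.Icc (p + 1) q, πh j := by
    have h := Finset.sum_Ioc_consecutive πh (Nat.zero_le p) hpq.le
    simpa only [← Finset.Icc_add_one_left_eq_Ioc, zero_add] using h.symm
  have hlen := (hmin (p + 1, q) ⟨by simp, hpq, hqm, by simp only; linarith⟩).1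
  have hbins : (j2 : ℝ) - ((j1 - 1 : ℕ) : ℝ) ≤ q - p := by
    have h : j2 + p ≤ q + (j1 - 1) := by
      simp only at hlen
      omega
    have : (j2 : ℝ) + p ≤ q + ((j1 - 1 : ℕ) : ℝ) := by exact_mod_cast h
    linarith
  calc b j2 - b (j1 - 1) = 2 * C / m * ((j2 : ℝ) - ((j1 - 1 : ℕ) : ℝ)) := by
        rw [hb, hb]
        ring
    _ ≤ 2 * C / m * (t - s + 2) := by
        gcongr
        linarith
    _ = (uo - lo) + 4 * C / m := by
        rw [hs, ht]
        field_simp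
        ring
end

section
/- Fix C > 0, m ∈ ℕ, η > 0 and τ ∈ (0,1]. Let x be such that the estimated histogram π̂(x) on the grid b_0,…,b_m satisfies max_{1 ≤ j ≤ m} | F̂(b_j | x) − F(b_j | x) | ≤ η^{1/3}, where F(· | x) is the true conditional CDF of Y given X = x. Then any optimal interval [ĵ_1, ĵ_2] for (π̂(x), τ) satisfies F(b_{ĵ_2} | x) − F(b_{ĵ_1 − 1} | x) ≥ τ − 2η^{1/3}; equivalently, P( Y ∈ (b_{ĵ_1 − 1}, b_{ĵ_2}] | X = x ) ≥ τ − 2η^{1/3}. -/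
/-- A sum over `1, …, u` splits at any `l` with `1 ≤ l ≤ u`. -/
theorem sum_Icc_one_pred_add_sum_Icc {M : Type*} [AddCommMonoid M] (f : ℕ → M) {l u : ℕ}
    (hl : 1 ≤ l) (hlu : l ≤ u) :
    ∑ j ∈ Finset.Icc 1 (l - 1), f j + ∑ j ∈ Finset.Icc l u, f j = ∑ j ∈ Finset.Icc 1 u, f j := by
  rw [← Finset.sum_union]
  · congr 1
    ext j
    simp only [Finset.mem_union, Finset.mem_Icc]
    omega
  · rw [Finset.disjoint_left]
    intro j
    simp only [Finset.mem_Icc]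
    omega

/--
**deterministic core of the near-conditional-coverage lemma.**  If the estimated
histogram `πh` on the grid `b j = -C + 2Cj/m` is uniformly `η^{1/3}`-accurate for the true
conditional CDF `F` (a monotone function vanishing at the left endpoint `b 0 = -C` of the grid),
then any optimal interval `[j₁, j₂]` for `(πh, τ)` has true conditional mass
`F (b j₂) - F (b (j₁ - 1)) ≥ τ - 2η^{1/3}`.
-/
theorem discrete_interval_coverage_lower_bound
    (C : ℝ) (hC : 0 < C) (m : ℕ) (hm : 1 ≤ m)
    (η τ : ℝ) (hη : 0 < η) (hτ0 : 0 < τ) (hτ1 : τ ≤ 1)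
    (b : ℕ → ℝ) (hb : ∀ j, b j = -C + 2 * C * j / m)
    (F : ℝ → ℝ) (hFmono : Monotone F) (hF0 : F (b 0) = 0)
    (πh : ℕ → ℝ) (hπ0 : ∀ j, 0 ≤ πh j) (hπ1 : ∑ j ∈ Finset.Icc 1 m, πh j = 1)
    (hacc : ∀ j, 1 ≤ j → j ≤ m →
      |(∑ j' ∈ Finset.Icc 1 j, πh j') - F (b j)| ≤ η ^ ((1 : ℝ) / 3))
    (j1 j2 : ℕ) (hj : IsOptimalInterval m πh τ (j1, j2)) :
    τ - 2 * η ^ ((1 : ℝ) / 3) ≤ F (b j2) - F (b (j1 - 1)) := by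
  obtain ⟨⟨h1, h12, h2m, hτ⟩, -⟩ := hj
  dsimp only at h1 h12 h2m hτ
  have hright := abs_le.mp (hacc j2 (h1.trans h12) h2m)
  have hleft : F (b (j1 - 1)) - ∑ j ∈ Finset.Icc 1 (j1 - 1), πh j ≤ η ^ ((1 : ℝ) / 3) := by
    rcases Nat.eq_zero_or_pos (j1 - 1) with h | h
    · rw [h, hF0]
      simpa using Real.rpow_nonneg hη.le _
    · linarith [(abs_le.mp (hacc (j1 - 1) h (by omega))).1]
  have hsplit := sum_Icc_one_pred_add_sum_Icc πh h1 h12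
  linarith [hright.2]
end

section
/- Fix C > 0, m ∈ ℕ, η > 0, K > 0 and τ ∈ (0,1]. Let x be such that the estimated histogram π̂(x) on the grid b_0,…,b_m is unimodal, satisfies π̂_j(x) ≤ Kη for every j ∈ {1,…,m}, and satisfies max_{1 ≤ j ≤ m} | F̂(b_j | x) − F(b_j | x) | ≤ η^{1/3}, where F(· | x) is the true conditional CDF of Y given X = x. Then any optimal interval [ĵ_1, ĵ_2] for (π̂(x), τ) satisfies F(b_{ĵ_2} | x) − F(b_{ĵ_1 − 1} | x) ≤ τ + 2Kη + 2η^{1/3}; equivalently, P( Y ∈ (b_{ĵ_1 − 1}, b_{ĵ_2}] | X = x ) ≤ τ + 2Kη + 2η^{1/3}. -/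
/-- The mass of an optimal interval exceeds the level by at most a bound on the bin masses. -/
theorem IsOptimalInterval.sum_le {m : ℕ} {π : ℕ → ℝ} {τ B : ℝ} {l u : ℕ} (hτ : 0 ≤ τ)
    (hB : ∀ j, 1 ≤ j → j ≤ m → π j ≤ B) (h : IsOptimalInterval m π τ (l, u)) :
    ∑ j ∈ Finset.Icc l u, π j ≤ τ + B := by
  obtain ⟨⟨hl, hlu, hu, -⟩, hmin⟩ := h
  simp only at hl hlu hu hmin
  have hBu := hB u (hl.trans hlu) hu
  rcases hlu.eq_or_lt with rfl | hlt
  · simp only [Finset.Icc_self, Finset.sum_singleton]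
    linarith
  · obtain ⟨v, rfl⟩ : ∃ v, u = v + 1 := ⟨u - 1, by omega⟩
    rw [Finset.sum_Icc_succ_top hlu]
    have hshort : ∑ j ∈ Finset.Icc l v, π j < τ := by
      by_contra! hge
      have hlen := (hmin (l, v) ⟨hl, Nat.le_of_lt_succ hlt, by omega, hge⟩).1
      simp only at hlen
      omega
    linarith

/--
**deterministic core of the quantile lower-bound lemma.**  If the estimated
histogram `πh` on the grid `b j = -C + 2Cj/m` is unimodal, has every bin mass at most `Kη`,
and is uniformly `η^{1/3}`-accurate for the true conditional CDF `F` (monotone, vanishing at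
the left endpoint of the grid), then any optimal interval `[j₁, j₂]` for `(πh, τ)` has true
conditional mass `F (b j₂) - F (b (j₁ - 1)) ≤ τ + 2Kη + 2η^{1/3}`.
-/
theorem discrete_interval_coverage_upper_bound
    (C : ℝ) (hC : 0 < C) (m : ℕ) (hm : 1 ≤ m)
    (η K τ : ℝ) (hη : 0 < η) (hK : 0 < K) (hτ0 : 0 < τ) (hτ1 : τ ≤ 1)
    (b : ℕ → ℝ) (hb : ∀ j, b j = -C + 2 * C * j / m)
    (F : ℝ → ℝ) (hFmono : Monotone F) (hF0 : F (b 0) = 0)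
    (πh : ℕ → ℝ) (hπ0 : ∀ j, 0 ≤ πh j) (hπ1 : ∑ j ∈ Finset.Icc 1 m, πh j = 1)
    (hπuni : ∃ j₀ ∈ Finset.Icc 1 m,
      (∀ j j', 1 ≤ j → j ≤ j' → j' ≤ j₀ → πh j ≤ πh j') ∧
      (∀ j j', j₀ ≤ j → j ≤ j' → j' ≤ m → πh j' ≤ πh j))
    (hπbdd : ∀ j, 1 ≤ j → j ≤ m → πh j ≤ K * η)
    (hacc : ∀ j, 1 ≤ j → j ≤ m →
      |(∑ j' ∈ Finset.Icc 1 j, πh j') - F (b j)| ≤ η ^ ((1 : ℝ) / 3))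
    (j1 j2 : ℕ) (hj : IsOptimalInterval m πh τ (j1, j2)) :
    F (b j2) - F (b (j1 - 1)) ≤ τ + 2 * K * η + 2 * η ^ ((1 : ℝ) / 3) := by
  obtain ⟨hj1, hj12, hj2, -⟩ := hj.1
  simp only at hj1 hj12 hj2
  have hmass := hj.sum_le hτ0.le hπbdd
  obtain ⟨k, rfl⟩ : ∃ k, j1 = k + 1 := ⟨j1 - 1, by omega⟩
  have hsplit : ∑ j ∈ Finset.Icc 1 j2, πh j =
      ∑ j ∈ Finset.Icc 1 k, πh j + ∑ j ∈ Finset.Icc (k + 1) j2, πh j := by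
    have hcons := Finset.sum_Ioc_consecutive πh (Nat.zero_le k) ((Nat.le_succ k).trans hj12)
    simpa only [← Finset.Icc_add_one_left_eq_Ioc, zero_add] using hcons.symm
  have hleft : ∑ j ∈ Finset.Icc 1 k, πh j - F (b k) ≤ η ^ ((1 : ℝ) / 3) := by
    rcases Nat.eq_zero_or_pos k with rfl | hk
    · simpa [hF0] using (Real.rpow_pos_of_pos hη _).le
    · exact (abs_le.mp (hacc k hk (by omega))).2
  have hright := (abs_le.mp (hacc j2 (hj1.trans hj12) hj2)).1
  have hKη : 0 < K * η := mul_pos hK hη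
  rw [Nat.add_sub_cancel]
  linarith
end

section
/- Let C > 0 and K > 0, and let f be a continuous probability density on ℝ supported on [−C, C] with f(y) > 1/K for all y ∈ [−C, C]. For τ ∈ (0,1], let L(τ) denote the minimal length u − l over real intervals [l, u] with ∫_{l}^{u} f(y) dy ≥ τ (the minimum is attained). Then L is nondecreasing and K-Lipschitz on (0,1]: for all 0 < τ_1 ≤ τ_2 ≤ 1, L(τ_2) − L(τ_1) ≤ K(τ_2 − τ_1). -/
open MeasureTheory

/-- The integral over an interval of a function supported on `[a, b]` is unchanged when the interval
is intersected with `[a, b]`. -/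
theorem intervalIntegral_eq_setIntegral_Icc_sup_inf {f : ℝ → ℝ} {a b l u : ℝ}
    (hf : ∀ y, y ∉ Set.Icc a b → f y = 0) (hlu : l ≤ u) :
    ∫ y in l..u, f y = ∫ y in Set.Icc (l ⊔ a) (u ⊓ b), f y := by
  rw [intervalIntegral.integral_of_le hlu, ← integral_Icc_eq_integral_Ioc, ← Set.Icc_inter_Icc]
  refine setIntegral_eq_of_subset_of_forall_sdiff_eq_zero measurableSet_Icc
    Set.inter_subset_left fun y hy => hf y fun hy' => hy.2 ⟨hy.1, hy'⟩

/-- A lower bound `c` for `f` on `[a, b]` bounds its integral below by `c * (b - a)`. -/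
theorem mul_sub_le_intervalIntegral {f : ℝ → ℝ} {a b c : ℝ} (hfint : Integrable f) (hab : a ≤ b)
    (hf : ∀ y ∈ Set.Icc a b, c ≤ f y) : c * (b - a) ≤ ∫ y in a..b, f y := by
  calc c * (b - a) = ∫ _ in a..b, c := by
        rw [intervalIntegral.integral_const, smul_eq_mul, mul_comm]
    _ ≤ ∫ y in a..b, f y :=
        intervalIntegral.integral_mono_on hab intervalIntegrable_const
          hfint.intervalIntegrable hf

/-- If `f` is at least `1 / K` on `[a, b]`, a subinterval `[l, u]` can be lengthened by `δ` inside
`[a, b]`, as long as there is room, gaining mass at least `δ / K`. -/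
theorem exists_Icc_extension {f : ℝ → ℝ} {a b l u K δ : ℝ} (hfint : Integrable f)
    (hf : ∀ y ∈ Set.Icc a b, 1 / K ≤ f y) (hal : a ≤ l) (hlu : l ≤ u) (hub : u ≤ b)
    (hδ : 0 ≤ δ) (hroom : u - l + δ ≤ b - a) :
    ∃ l' u', l' ≤ u' ∧ u' - l' = u - l + δ ∧
      (∫ y in l..u, f y) + 1 / K * δ ≤ ∫ y in l'..u', f y := by
  obtain ⟨r, hr0, hrδ, hrb, hra⟩ : ∃ r, 0 ≤ r ∧ r ≤ δ ∧ u + r ≤ b ∧ a ≤ l - (δ - r) := by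
    rcases le_total δ (b - u) with h | h
    · exact ⟨δ, hδ, le_rfl, by linarith, by linarith⟩
    · exact ⟨b - u, by linarith, h, by linarith, by linarith⟩
  refine ⟨l - (δ - r), u + r, by linarith, by ring, ?_⟩
  have hleft := mul_sub_le_intervalIntegral (a := l - (δ - r)) (b := l) hfint (by linarith)
    fun y hy => hf y ⟨by linarith [hy.1], by linarith [hy.2]⟩
  have hright := mul_sub_le_intervalIntegral (a := u) (b := u + r) hfint (by linarith)
    fun y hy => hf y ⟨by linarith [hy.1], by linarith [hy.2]⟩
  have hsplit : (∫ y in (l - (δ - r))..l, f y) + (∫ y in l..u, f y) + (∫ y in u..(u + r), f y) =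
      ∫ y in (l - (δ - r))..(u + r), f y := by
    rw [intervalIntegral.integral_add_adjacent_intervals hfint.intervalIntegrable
        hfint.intervalIntegrable,
      intervalIntegral.integral_add_adjacent_intervals hfint.intervalIntegrable
        hfint.intervalIntegrable]
  linarith

/--
**oracle interval length is nondecreasing and K-Lipschitz.**  Let `f` be a
continuous probability density supported on `[-C, C]` with `f > 1/K` on `[-C, C]`, and for
`τ ∈ (0,1]` let `L τ` be the minimal length `u - l` over real intervals `[l,u]` with
`∫_{l}^{u} f ≥ τ`.  Then `L` is nondecreasing and `K`-Lipschitz on `(0,1]`: for all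
`0 < τ₁ ≤ τ₂ ≤ 1`, `L τ₁ ≤ L τ₂` and `L τ₂ - L τ₁ ≤ K (τ₂ - τ₁)`.
-/
theorem oracle_length_monotone_lipschitz
    (C K : ℝ) (hC : 0 < C) (hK : 0 < K)
    (f : ℝ → ℝ) (hf0 : ∀ y, 0 ≤ f y)
    (hfcont : ContinuousOn f (Set.Icc (-C) C))
    (hfsupp : ∀ y, y ∉ Set.Icc (-C) C → f y = 0)
    (hfint : Integrable f) (hftot : (∫ y, f y) = 1)
    (hfpos : ∀ y ∈ Set.Icc (-C) C, 1 / K < f y)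
    (L : ℝ → ℝ)
    (hL : ∀ τ, L τ = sInf {d : ℝ | ∃ l u : ℝ, l ≤ u ∧ d = u - l ∧ τ ≤ ∫ y in l..u, f y}) :
    ∀ τ₁ τ₂ : ℝ, 0 < τ₁ → τ₁ ≤ τ₂ → τ₂ ≤ 1 →
      L τ₁ ≤ L τ₂ ∧ L τ₂ - L τ₁ ≤ K * (τ₂ - τ₁) := by
  intro τ₁ τ₂ hτ₁ hτ hτ₂
  rw [hL, hL]
  set S : ℝ → Set ℝ := fun τ =>
    {d : ℝ | ∃ l u : ℝ, l ≤ u ∧ d = u - l ∧ τ ≤ ∫ y in l..u, f y}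
  change sInf (S τ₁) ≤ sInf (S τ₂) ∧ sInf (S τ₂) - sInf (S τ₁) ≤ K * (τ₂ - τ₁)
  have hbdd : ∀ τ, BddBelow (S τ) := fun τ => ⟨0, by
    rintro d ⟨l, u, hlu, rfl, -⟩
    exact sub_nonneg.2 hlu⟩
  have hfull : 2 * C ∈ S τ₂ := by
    refine ⟨-C, C, by linarith, by ring, ?_⟩
    rw [intervalIntegral.integral_of_le (by linarith), ← integral_Icc_eq_integral_Ioc,
      setIntegral_eq_integral_of_forall_compl_eq_zero hfsupp, hftot]
    exact hτ₂
  have hsub : S τ₂ ⊆ S τ₁ := by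
    rintro d ⟨l, u, hlu, hd, hmass⟩
    exact ⟨l, u, hlu, hd, hτ.trans hmass⟩
  refine ⟨csInf_le_csInf (hbdd τ₁) ⟨_, hfull⟩ hsub, ?_⟩
  suffices h : sInf (S τ₂) - K * (τ₂ - τ₁) ≤ sInf (S τ₁) by linarith
  refine le_csInf ⟨_, hsub hfull⟩ ?_
  rintro d ⟨l, u, hlu, rfl, hmass⟩
  rw [intervalIntegral_eq_setIntegral_Icc_sup_inf hfsupp hlu] at hmass
  have hle : l ⊔ -C ≤ u ⊓ C := by
    by_contra h
    rw [Set.Icc_eq_empty h, setIntegral_empty] at hmass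
    linarith
  rw [integral_Icc_eq_integral_Ioc, ← intervalIntegral.integral_of_le hle] at hmass
  have hl : l ≤ l ⊔ -C := le_sup_left
  have hu : u ⊓ C ≤ u := inf_le_left
  have hδ : 0 ≤ K * (τ₂ - τ₁) := mul_nonneg hK.le (sub_nonneg.2 hτ)
  rcases le_total (C - -C) (u ⊓ C - l ⊔ -C + K * (τ₂ - τ₁)) with hroom | hroom
  · linarith [csInf_le (hbdd τ₂) hfull]
  · obtain ⟨l', u', hlu', hlen, hmass'⟩ := exists_Icc_extension hfint
      (fun y hy => (hfpos y hy).le) le_sup_right hle inf_le_right hδ hroom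
    have hgain : 1 / K * (K * (τ₂ - τ₁)) = τ₂ - τ₁ := by field_simp
    have := csInf_le (hbdd τ₂) ⟨l', u', hlu', rfl, by linarith⟩
    linarith
end
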